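/- For all x, y ∈ ℂ, the element r = x(X₊∧X₋ + V₊∧W₋ − V₋∧W₊) + y H∧B of G⊗G for the osp(2|2) Lie superalgebra G defines a co-Lie structure by δ_r(z) := z·r; that is, δ_r satisfies the parity condition, graded antisymmetry, the graded co-Jacobi identity, and the 1-cocycle condition. -/

import Mathlib

noncomputable section

open scoped BigOperators

/-- The underlying vector space of `osp(2|2)`, with coordinates in the basis
`(g₀,…,g₇) = (H, X₊, X₋, B, V₊, V₋, W₊, W₋)`. -/
abbrev G := Fin 8 → ℂ

/-- `G ⊗ G`, represented by coefficient matrices in the basis `gᵢ ⊗ gⱼ`. -/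
abbrev TT := Fin 8 → Fin 8 → ℂ

/-- The grade: `H, X₊, X₋, B` are even (0); `V₊, V₋, W₊, W₋` are odd (1). -/
def gr (i : Fin 8) : ℕ := if i.val < 4 then 0 else 1

/-- The sign `z(i,j) = (−1)^{|i||j|}`. -/
def zz (i j : Fin 8) : ℂ := (-1 : ℂ) ^ (gr i * gr j)

/-- Structure constants of `osp(2|2)` (on `ℕ` indices, 0 outside the table). -/
def cNat : ℕ → ℕ → ℕ → ℂ
  | 0,1,1 => 1 | 1,0,1 => -1
  | 0,2,2 => -1 | 2,0,2 => 1
  | 1,2,0 => -2 | 2,1,0 => 2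
  | 0,4,4 => 1/2 | 4,0,4 => -1/2
  | 0,5,5 => -1/2 | 5,0,5 => 1/2
  | 0,6,6 => 1/2 | 6,0,6 => -1/2
  | 0,7,7 => -1/2 | 7,0,7 => 1/2
  | 3,4,4 => 1/2 | 4,3,4 => -1/2
  | 3,5,5 => 1/2 | 5,3,5 => -1/2
  | 3,6,6 => -1/2 | 6,3,6 => 1/2
  | 3,7,7 => -1/2 | 7,3,7 => 1/2
  | 1,5,4 => -1 | 5,1,4 => 1
  | 2,4,5 => 1 | 4,2,5 => -1
  | 1,7,6 => -1 | 7,1,6 => 1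
  | 2,6,7 => 1 | 6,2,7 => -1
  | 4,7,0 => 1 | 4,7,3 => -1 | 7,4,0 => 1 | 7,4,3 => -1
  | 6,5,0 => 1 | 6,5,3 => 1 | 5,6,0 => 1 | 5,6,3 => 1
  | 4,6,1 => 1 | 6,4,1 => 1
  | 5,7,2 => 1 | 7,5,2 => 1
  | _,_,_ => 0

/-- Structure constants `c i j k`, so that `μ(gᵢ,gⱼ) = Σ_k c i j k • g_k`. -/
def c (i j k : Fin 8) : ℂ := cNat i.val j.val k.val

/-- The bracket `μ` of `osp(2|2)`, extended bilinearly from the basis. -/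
def mu (u v : G) : G := fun k => ∑ i, ∑ j, u i * v j * c i j k

/-- The basis vectors `g₀,…,g₇`. -/
def e (i : Fin 8) : G := Pi.single i 1

/-- Membership in the even part `G₀ = span{H, X₊, X₋, B}`. -/
def isEven (v : G) : Prop := ∀ i : Fin 8, 4 ≤ i.val → v i = 0

/-- Membership in the odd part `G₁ = span{V₊, V₋, W₊, W₋}`. -/
def isOdd (v : G) : Prop := ∀ i : Fin 8, i.val < 4 → v i = 0

/-- The action of the basis vector `gᵢ` on `G ⊗ G`:
`gᵢ·(u⊗v) = μ(gᵢ,u)⊗v + (−1)^{|i||u|} u⊗μ(gᵢ,v)`. -/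
def actB (i : Fin 8) (r : TT) : TT :=
  fun p q => (∑ j, c i j p * r j q) + zz i p * ∑ j, c i j q * r p j

/-- The (bilinearly extended) action `x ↦ x·r` of `G` on `G ⊗ G`, as a linear map in `x`. -/
def actL (r : TT) : G →ₗ[ℂ] TT :=
  ∑ i : Fin 8, LinearMap.smulRight (LinearMap.proj i : G →ₗ[ℂ] ℂ) (actB i r)

/-- The graded wedge `gᵢ ∧ gⱼ = gᵢ⊗gⱼ − (−1)^{|i||j|} gⱼ⊗gᵢ` as an element of `G ⊗ G`. -/
def wdg (i j : Fin 8) : TT :=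
  fun p q => (if p = i ∧ q = j then (1 : ℂ) else 0)
    - zz i j * (if p = j ∧ q = i then (1 : ℂ) else 0)

/-- Parity condition: for homogeneous `x` of grade `a`, `δ x` lies in the sum of the
`G_b ⊗ G_c` with `b + c ≡ a (mod 2)`. -/
def Parity (δ : G →ₗ[ℂ] TT) : Prop :=
  (∀ x, isEven x → ∀ p q : Fin 8, (gr p + gr q) % 2 = 1 → δ x p q = 0) ∧
  (∀ x, isOdd x → ∀ p q : Fin 8, (gr p + gr q) % 2 = 0 → δ x p q = 0)

/-- Graded antisymmetry of the values of `δ`: `f_i^{jk} = −(−1)^{|j||k|} f_i^{kj}`. -/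
def Antisym (δ : G →ₗ[ℂ] TT) : Prop :=
  ∀ i j k : Fin 8, δ (e i) j k = - zz j k * δ (e i) k j

/-- The graded co-Jacobi identity for the structure constants `f_i^{jk} = δ(gᵢ) j k`. -/
def CoJacobi (δ : G →ₗ[ℂ] TT) : Prop :=
  ∀ i k l m : Fin 8, ∑ j : Fin 8,
    (δ (e i) k j * δ (e j) l m * zz k m + δ (e i) l j * δ (e j) m k * zz l k
      + δ (e i) m j * δ (e j) k l * zz m l) = 0

/-- The 1-cocycle condition `δ(μ(x,y)) = x·δ(y) − (−1)^{|x||y|} y·δ(x)` for homogeneous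
`x, y` (the sign is `+1` unless both are odd). -/
def Cocycle (δ : G →ₗ[ℂ] TT) : Prop :=
  (∀ x y, (isEven x ∨ isEven y) → δ (mu x y) = actL (δ y) x - actL (δ x) y) ∧
  (∀ x y, isOdd x → isOdd y → δ (mu x y) = actL (δ y) x + actL (δ x) y)

/-- A co-Lie structure (Lie super-bialgebra structure) on `osp(2|2)`. -/
def IsCoLie (δ : G →ₗ[ℂ] TT) : Prop := Parity δ ∧ Antisym δ ∧ CoJacobi δ ∧ Cocycle δ

/-- Twice the structure constants. -/
def czN : ℕ → ℕ → ℕ → ℤ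
  | 0,1,1 => 2 | 1,0,1 => -2 | 0,2,2 => -2 | 2,0,2 => 2 | 1,2,0 => -4 | 2,1,0 => 4
  | 0,4,4 => 1 | 4,0,4 => -1 | 0,5,5 => -1 | 5,0,5 => 1 | 0,6,6 => 1 | 6,0,6 => -1
  | 0,7,7 => -1 | 7,0,7 => 1 | 3,4,4 => 1 | 4,3,4 => -1 | 3,5,5 => 1 | 5,3,5 => -1
  | 3,6,6 => -1 | 6,3,6 => 1 | 3,7,7 => -1 | 7,3,7 => 1 | 1,5,4 => -2 | 5,1,4 => 2
  | 2,4,5 => 2 | 4,2,5 => -2 | 1,7,6 => -2 | 7,1,6 => 2 | 2,6,7 => 2 | 6,2,7 => -2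
  | 4,7,0 => 2 | 4,7,3 => -2 | 7,4,0 => 2 | 7,4,3 => -2 | 6,5,0 => 2 | 6,5,3 => 2
  | 5,6,0 => 2 | 5,6,3 => 2 | 4,6,1 => 2 | 6,4,1 => 2 | 5,7,2 => 2 | 7,5,2 => 2
  | _,_,_ => 0

/-- Twice the cobracket coming from the `x` part. -/
def f1N : ℕ → ℕ → ℕ → ℤ
  | 1,0,1 => 4 | 1,1,0 => -4 | 2,0,2 => 4 | 2,2,0 => -4 | 4,0,4 => 2 | 4,1,5 => -4
  | 4,3,4 => -2 | 4,4,0 => -2 | 4,4,3 => 2 | 4,5,1 => 4 | 5,0,5 => -2 | 5,3,5 => -2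
  | 5,5,0 => 2 | 5,5,3 => 2 | 6,0,6 => -2 | 6,3,6 => -2 | 6,6,0 => 2 | 6,6,3 => 2
  | 7,0,7 => 2 | 7,2,6 => -4 | 7,3,7 => -2 | 7,6,2 => 4 | 7,7,0 => -2 | 7,7,3 => 2
  | _,_,_ => 0

/-- Twice the cobracket coming from the `y` part. -/
def f2N : ℕ → ℕ → ℕ → ℤ
  | 1,1,3 => -2 | 1,3,1 => 2 | 2,2,3 => 2 | 2,3,2 => -2 | 4,0,4 => -1 | 4,3,4 => 1
  | 4,4,0 => 1 | 4,4,3 => -1 | 5,0,5 => -1 | 5,3,5 => -1 | 5,5,0 => 1 | 5,5,3 => 1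
  | 6,0,6 => 1 | 6,3,6 => 1 | 6,6,0 => -1 | 6,6,3 => -1 | 7,0,7 => 1 | 7,3,7 => -1
  | 7,7,0 => -1 | 7,7,3 => 1
  | _,_,_ => 0

def cz (i j k : Fin 8) : ℤ := czN i.val j.val k.val

def f1 (i j k : Fin 8) : ℤ := f1N i.val j.val k.val

def f2 (i j k : Fin 8) : ℤ := f2N i.val j.val k.val

/-- Integer version of the sign. -/
def zi (i j : Fin 8) : ℤ := if 4 ≤ i.val then (if 4 ≤ j.val then -1 else 1) else 1

/-- Explicit eight-term sum. -/
def S8 (g : Fin 8 → ℤ) : ℤ := g 0 + g 1 + g 2 + g 3 + g 4 + g 5 + g 6 + g 7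

/-- Integer matrix of `X₊∧X₋ + V₊∧W₋ − V₋∧W₊`. -/
def r1N : ℕ → ℕ → ℤ
  | 1,2 => 1 | 2,1 => -1 | 4,7 => 1 | 7,4 => 1 | 5,6 => -1 | 6,5 => -1
  | _,_ => 0

/-- Integer matrix of `H∧B`. -/
def r2N : ℕ → ℕ → ℤ
  | 0,3 => 1 | 3,0 => -1
  | _,_ => 0

/-- Multiplication which does not evaluate its second argument when the first one vanishes. -/
def sm : ℤ → ℤ → ℤ
  | Int.ofNat 0, _ => 0
  | Int.ofNat (n + 1), b => Int.ofNat (n + 1) * b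
  | Int.negSucc n, b => Int.negSucc n * b

theorem sm_eq (a b : ℤ) : sm a b = a * b := by
  unfold sm
  split <;> simp

/-- Twice the action of a basis vector on an integer matrix. -/
def actZ (i : Fin 8) (r : Fin 8 → Fin 8 → ℤ) (p q : Fin 8) : ℤ :=
  S8 (fun j => sm (cz i j p) (r j q)) + zi i p * S8 (fun j => sm (cz i j q) (r p j))

/-- Integer (polarised) co-Jacobi expression. -/
def cjZ (a b : Fin 8 → Fin 8 → Fin 8 → ℤ) (i k l m : Fin 8) : ℤ :=
  S8 (fun j => sm (a i k j) (sm (b j l m) (zi k m)) + sm (a i l j) (sm (b j m k) (zi l k))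
      + sm (a i m j) (sm (b j k l) (zi m l)))

theorem czN_eq (i j k : ℕ) : cNat i j k = (czN i j k : ℂ) / 2 := by
  delta cNat czN
  split <;> norm_num

theorem cz_eq (i j k : Fin 8) : c i j k = (cz i j k : ℂ) / 2 :=
  czN_eq i.val j.val k.val

theorem zi_eq (i j : Fin 8) : zz i j = (zi i j : ℂ) := by
  unfold zz zi gr
  by_cases hi : i.val < 4 <;> by_cases hj : j.val < 4 <;>
    simp [hi, hj, Nat.not_le.mpr, Nat.not_lt.mp]

theorem r_eq (x y : ℂ) (p q : Fin 8) :
    (x • (wdg 1 2 + wdg 4 7 - wdg 5 6) + y • wdg 0 3 : TT) p q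
      = x * (r1N p q : ℤ) + y * (r2N p q : ℤ) := by
  fin_cases p <;> fin_cases q <;> simp [wdg, zz, gr, r1N, r2N]

theorem f1_eq : ∀ i p q : Fin 8, actZ i (fun p q => r1N p q) p q = f1 i p q := by
  decide +kernel

theorem f2_eq : ∀ i p q : Fin 8, actZ i (fun p q => r2N p q) p q = f2 i p q := by
  decide +kernel

theorem anti_f1 : ∀ i p q : Fin 8, f1 i p q = - zi p q * f1 i q p := by
  decide +kernel

theorem anti_f2 : ∀ i p q : Fin 8, f2 i p q = - zi p q * f2 i q p := by
  decide +kernel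

theorem par_f1 : ∀ i p q : Fin 8, (gr i + gr p + gr q) % 2 = 1 → f1 i p q = 0 := by
  decide +kernel

theorem par_f2 : ∀ i p q : Fin 8, (gr i + gr p + gr q) % 2 = 1 → f2 i p q = 0 := by
  decide +kernel

theorem cj11 : ∀ i k l m : Fin 8, cjZ f1 f1 i k l m = 0 := by
  decide +kernel

theorem cj22 : ∀ i k l m : Fin 8, cjZ f2 f2 i k l m = 0 := by
  decide +kernel

theorem cj12 : ∀ i k l m : Fin 8, cjZ f1 f2 i k l m + cjZ f2 f1 i k l m = 0 := by
  decide +kernel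

theorem coc1 : ∀ i j p q : Fin 8, S8 (fun k => sm (cz i j k) (f1 k p q))
    = actZ i (f1 j) p q - zi i j * actZ j (f1 i) p q := by
  decide +kernel

theorem coc2 : ∀ i j p q : Fin 8, S8 (fun k => sm (cz i j k) (f2 k p q))
    = actZ i (f2 j) p q - zi i j * actZ j (f2 i) p q := by
  decide +kernel

theorem actL_apply' (r : TT) (u : G) (p q : Fin 8) :
    actL r u p q = ∑ i, u i * actB i r p q := by
  simp [actL, LinearMap.sum_apply, Finset.sum_apply]

theorem actL_e (r : TT) (i p q : Fin 8) : actL r (e i) p q = actB i r p q := by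
  rw [actL_apply']
  simp [e, Pi.single_apply]

theorem actB_sum (i : Fin 8) (v : G) (F : Fin 8 → TT) (r : TT)
    (hr : ∀ p q, r p q = ∑ j, v j * F j p q) (p q : Fin 8) :
    actB i r p q = ∑ j, v j * actB i (F j) p q := by
  simp only [actB, hr, mul_add, Finset.sum_add_distrib, Finset.mul_sum]
  congr 1
  · rw [Finset.sum_comm]
    exact Finset.sum_congr rfl fun _ _ => Finset.sum_congr rfl fun _ _ => by ring
  · rw [Finset.sum_comm]
    exact Finset.sum_congr rfl fun _ _ => Finset.sum_congr rfl fun _ _ => by ring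

theorem actB_lin (i : Fin 8) (r : TT) (a b : Fin 8 → Fin 8 → ℤ) (x y : ℂ)
    (hr : ∀ p q, r p q = x * (a p q : ℂ) + y * (b p q : ℂ)) (p q : Fin 8) :
    actB i r p q = (x * (actZ i a p q : ℤ) + y * (actZ i b p q : ℤ)) / 2 := by
  simp only [actB, hr, cz_eq, zi_eq, actZ, S8, sm_eq, Fin.sum_univ_eight]
  push_cast
  ring

/-- The matrix `r` of the theorem. -/
def rr (x y : ℂ) : TT := x • (wdg 1 2 + wdg 4 7 - wdg 5 6) + y • wdg 0 3

theorem F_eq (x y : ℂ) (i p q : Fin 8) :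
    actB i (rr x y) p q = (x * (f1 i p q : ℂ) + y * (f2 i p q : ℂ)) / 2 := by
  rw [actB_lin i (rr x y) (fun p q => r1N p q) (fun p q => r2N p q) x y (r_eq x y),
    f1_eq, f2_eq]

theorem F_coc (x y : ℂ) (i j p q : Fin 8) :
    ∑ k, c i j k * actB k (rr x y) p q
      = actB i (actB j (rr x y)) p q - zz i j * actB j (actB i (rr x y)) p q := by
  have h : ∀ j p q, actB j (rr x y) p q = x / 2 * (f1 j p q : ℂ) + y / 2 * (f2 j p q : ℂ) := by
    intro j p q
    rw [F_eq]; ring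
  rw [actB_lin i _ (f1 j) (f2 j) (x / 2) (y / 2) (h j),
    actB_lin j _ (f1 i) (f2 i) (x / 2) (y / 2) (h i)]
  have h1 := congrArg (Int.cast : ℤ → ℂ) (coc1 i j p q)
  have h2 := congrArg (Int.cast : ℤ → ℂ) (coc2 i j p q)
  simp only [h, cz_eq, zi_eq, Fin.sum_univ_eight]
  simp only [S8, sm_eq] at h1 h2
  push_cast at h1 h2
  linear_combination (x / 4) * h1 + (y / 4) * h2

theorem lhs_sum (x y : ℂ) (u v : G) (p q : Fin 8) :
    actL (rr x y) (mu u v) p q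
      = ∑ i, ∑ j, u i * v j * (actB i (actB j (rr x y)) p q
          - zz i j * actB j (actB i (rr x y)) p q) := by
  simp only [← F_coc, actL_apply', mu, Finset.sum_mul, Finset.mul_sum]
  rw [Finset.sum_comm]
  refine Finset.sum_congr rfl fun i _ => ?_
  rw [Finset.sum_comm]
  exact Finset.sum_congr rfl fun _ _ => Finset.sum_congr rfl fun _ _ => by ring

theorem rhs_sum (x y : ℂ) (u v : G) (p q : Fin 8) :
    actL (actL (rr x y) v) u p q
      = ∑ i, ∑ j, u i * v j * actB i (actB j (rr x y)) p q := by
  rw [actL_apply']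
  refine Finset.sum_congr rfl fun i _ => ?_
  rw [actB_sum i v (fun j => actB j (rr x y)) _ (actL_apply' _ _), Finset.mul_sum]
  exact Finset.sum_congr rfl fun _ _ => by ring

theorem rhs_sum' (x y : ℂ) (u v : G) (p q : Fin 8) :
    actL (actL (rr x y) u) v p q
      = ∑ i, ∑ j, u i * v j * actB j (actB i (rr x y)) p q := by
  rw [rhs_sum, Finset.sum_comm]
  exact Finset.sum_congr rfl fun _ _ => Finset.sum_congr rfl fun _ _ => by ring

theorem parity_rr (x y : ℂ) : Parity (actL (rr x y)) := by
  constructor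
  · intro u hu p q hpq
    rw [actL_apply']
    refine Finset.sum_eq_zero fun i _ => ?_
    by_cases hi : 4 ≤ i.val
    · rw [hu i hi, zero_mul]
    · have hg : gr i = 0 := by simp [gr]; omega
      rw [F_eq, par_f1 i p q (by omega), par_f2 i p q (by omega)]
      simp
  · intro u hu p q hpq
    rw [actL_apply']
    refine Finset.sum_eq_zero fun i _ => ?_
    by_cases hi : i.val < 4
    · rw [hu i hi, zero_mul]
    · have hg : gr i = 1 := by simp [gr]; omega
      rw [F_eq, par_f1 i p q (by omega), par_f2 i p q (by omega)]
      simp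

theorem antisym_rr (x y : ℂ) : Antisym (actL (rr x y)) := by
  intro i j k
  rw [actL_e, actL_e, F_eq, F_eq, zi_eq]
  have h1 := congrArg (Int.cast : ℤ → ℂ) (anti_f1 i j k)
  have h2 := congrArg (Int.cast : ℤ → ℂ) (anti_f2 i j k)
  push_cast at h1 h2
  linear_combination (x / 2) * h1 + (y / 2) * h2

theorem coJacobi_rr (x y : ℂ) : CoJacobi (actL (rr x y)) := by
  intro i k l m
  have h1 := congrArg (Int.cast : ℤ → ℂ) (cj11 i k l m)
  have h2 := congrArg (Int.cast : ℤ → ℂ) (cj12 i k l m)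
  have h3 := congrArg (Int.cast : ℤ → ℂ) (cj22 i k l m)
  simp only [actL_e, F_eq, zi_eq, Fin.sum_univ_eight]
  simp only [cjZ, S8, sm_eq] at h1 h2 h3
  push_cast at h1 h2 h3
  linear_combination (x ^ 2 / 4) * h1 + (x * y / 4) * h2 + (y ^ 2 / 4) * h3

theorem cocycle_rr (x y : ℂ) : Cocycle (actL (rr x y)) := by
  constructor
  · intro u v huv
    funext p q
    rw [Pi.sub_apply, Pi.sub_apply, lhs_sum, rhs_sum, rhs_sum', ← Finset.sum_sub_distrib]
    refine Finset.sum_congr rfl fun i _ => ?_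
    rw [← Finset.sum_sub_distrib]
    refine Finset.sum_congr rfl fun j _ => ?_
    have key : u i * v j * zz i j = u i * v j := by
      rcases huv with h | h
      · by_cases hi : 4 ≤ i.val
        · simp [h i hi]
        · simp [zz, gr, not_le.mp hi]
      · by_cases hj : 4 ≤ j.val
        · simp [h j hj]
        · simp [zz, gr, not_le.mp hj]
    linear_combination (- actB j (actB i (rr x y)) p q) * key
  · intro u v hu hv
    funext p q
    rw [Pi.add_apply, Pi.add_apply, lhs_sum, rhs_sum, rhs_sum', ← Finset.sum_add_distrib]
    refine Finset.sum_congr rfl fun i _ => ?_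
    rw [← Finset.sum_add_distrib]
    refine Finset.sum_congr rfl fun j _ => ?_
    have key : u i * v j * zz i j = - (u i * v j) := by
      by_cases hi : i.val < 4
      · simp [hu i hi]
      · by_cases hj : j.val < 4
        · simp [hv j hj]
        · simp [zz, gr, hi, hj]
    linear_combination (- actB j (actB i (rr x y)) p q) * key

/-- `r = x(X₊∧X₋ + V₊∧W₋ − V₋∧W₊) + y H∧B` defines a co-Lie structure on
`osp(2|2)` via `δ_r(z) = z·r`. -/
theorem stmt9 (x y : ℂ) :
    IsCoLie (actL (x • (wdg 1 2 + wdg 4 7 - wdg 5 6) + y • wdg 0 3)) := by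
  exact ⟨parity_rr x y, antisym_rr x y, coJacobi_rr x y, cocycle_rr x y⟩

end
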